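/- Let T ≥ 2, let φ ∈ ℝ with 0 < |φ| < 1, let σ > 0, and set σ_α² = σ²/(1−φ²). Let Q be the T×T symmetric tridiagonal matrix with Q_{11} = Q_{TT} = 1/σ², Q_{tt} = (1+φ²)/σ² for 2 ≤ t ≤ T−1, Q_{t,t+1} = Q_{t+1,t} = −φ/σ², and all other entries zero (this Q is the precision matrix of the stationary AR(1) process). Let l : ℝ^T → ℝ be measurable and suppose there exist k ∈ ℝ and δ ∈ ℝ^T with l(α) ≤ k + δᵀα for all α. Let n ≥ 1 be real, let v > 0 satisfy v ≥ (n−1) σ_α² (1+|φ|)/(1−|φ|), let μ, μ* ∈ ℝ^T, let g(α) = N(α|μ*, (Q + v⁻¹ I_T)⁻¹), and define ω(α) = exp(l(α)) N(α|μ, Q⁻¹)/g(α). Then ∫_{ℝ^T} ω(α)^n g(α) dα is finite. -/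

import Mathlib

open MeasureTheory Matrix Filter

/-- The Gaussian density `N(·|μ, P⁻¹)` on `ℝ^d` with mean `μ` and precision matrix `P`. -/
noncomputable def gaussDensity {d : ℕ} (μ : Fin d → ℝ) (P : Matrix (Fin d) (Fin d) ℝ)
    (α : Fin d → ℝ) : ℝ :=
  (2 * Real.pi) ^ (-(d : ℝ) / 2) * Real.sqrt P.det *
    Real.exp (-(1 / 2) * ((α - μ) ⬝ᵥ P.mulVec (α - μ)))

/-- The `T×T` precision matrix of the stationary scalar AR(1) process with
autoregressive coefficient `φ` and innovation variance `σ²`. -/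
noncomputable def ar1Precision (T : ℕ) (φ σ : ℝ) : Matrix (Fin T) (Fin T) ℝ :=
  Matrix.of fun i j =>
    if i = j then
      (if i.val = 0 ∨ i.val = T - 1 then 1 / σ ^ 2 else (1 + φ ^ 2) / σ ^ 2)
    else if i.val + 1 = j.val ∨ j.val + 1 = i.val then -φ / σ ^ 2
    else 0

/-- The quadratic form of the AR(1) precision matrix, as a sum over consecutive pairs. -/
lemma dotProduct_ar1Precision_mulVec (m : ℕ) (hm : 1 ≤ m) (φ σ : ℝ) (hσ : 0 < σ)
    (x : Fin (m + 1) → ℝ) :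
    σ ^ 2 * (x ⬝ᵥ (ar1Precision (m + 1) φ σ).mulVec x) =
      (1 + φ ^ 2) * ∑ i, x i ^ 2 - φ ^ 2 * (x 0 ^ 2 + x (Fin.last m) ^ 2)
        - 2 * φ * ∑ i : Fin m, x i.castSucc * x i.succ := by
  have hentry : ∀ i j : Fin (m + 1), σ ^ 2 * ar1Precision (m + 1) φ σ i j =
      (if i = j then (1 + φ ^ 2) - (if i = 0 then φ ^ 2 else 0)
        - (if i = Fin.last m then φ ^ 2 else 0) else 0)
      + (if i.val + 1 = j.val then -φ else 0) + (if j.val + 1 = i.val then -φ else 0) := by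
    intro i j
    simp only [ar1Precision, Matrix.of_apply, Fin.ext_iff, Fin.val_zero, Fin.val_last,
      Nat.add_sub_cancel]
    split_ifs <;> first | omega | (field_simp; try ring)
  have hup : ∑ i : Fin (m + 1), ∑ j : Fin (m + 1),
      x i * (if i.val + 1 = j.val then -φ else 0) * x j
      = -φ * ∑ i : Fin m, x i.castSucc * x i.succ := by
    rw [Fin.sum_univ_castSucc]
    have hlast : ∀ j : Fin (m + 1), ¬ (m + 1 = j.val) := fun j => by omega
    simp only [Fin.val_last, hlast, Fin.sum_univ_succ (n := m), Fin.val_castSucc, Fin.val_succ,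
      Fin.val_zero, Nat.succ_ne_zero, Nat.add_right_cancel_iff, ← Fin.ext_iff]
    simp [Finset.mul_sum]
    exact Finset.sum_congr rfl fun i _ => by ring
  have hdown : ∑ i : Fin (m + 1), ∑ j : Fin (m + 1),
      x i * (if j.val + 1 = i.val then -φ else 0) * x j
      = -φ * ∑ i : Fin m, x i.castSucc * x i.succ := by
    rw [Finset.sum_comm, ← hup]
    exact Finset.sum_congr rfl fun i _ => Finset.sum_congr rfl fun j _ => by ring
  have hdiag : ∑ i : Fin (m + 1), ∑ j : Fin (m + 1),
      x i * (if i = j then (1 + φ ^ 2) - (if i = 0 then φ ^ 2 else 0)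
        - (if i = Fin.last m then φ ^ 2 else 0) else 0) * x j
      = (1 + φ ^ 2) * ∑ i, x i ^ 2 - φ ^ 2 * (x 0 ^ 2 + x (Fin.last m) ^ 2) := by
    simp only [mul_ite, ite_mul, mul_zero, zero_mul, Finset.sum_ite_eq, Finset.mem_univ, if_true,
      mul_sub, sub_mul, Finset.sum_sub_distrib, Finset.sum_ite_eq']
    rw [Finset.mul_sum]
    have : ∀ i, x i * (1 + φ ^ 2) * x i = (1 + φ ^ 2) * x i ^ 2 := fun i => by ring
    simp only [this]
    ring
  have hexpand : σ ^ 2 * (x ⬝ᵥ (ar1Precision (m + 1) φ σ).mulVec x) =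
      ∑ i, ∑ j, x i * (σ ^ 2 * ar1Precision (m + 1) φ σ i j) * x j := by
    simp only [dotProduct, mulVec, Finset.mul_sum]
    exact Finset.sum_congr rfl fun i _ => Finset.sum_congr rfl fun j _ => by ring
  rw [hexpand]
  simp only [hentry, mul_add, add_mul, Finset.sum_add_distrib]
  rw [hup, hdown, hdiag]
  ring

/-- Every eigenvalue of the AR(1) precision matrix exceeds `(1 - |φ|)² / σ²`. -/
lemma ar1Precision_strict_lower_bound (T : ℕ) (hT : 2 ≤ T) (φ : ℝ) (hφ0 : φ ≠ 0)
    (hφ1 : |φ| < 1) (σ : ℝ) (hσ : 0 < σ) (x : Fin T → ℝ) (hx : x ≠ 0) :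
    (1 - |φ|) ^ 2 / σ ^ 2 * (x ⬝ᵥ x) < x ⬝ᵥ (ar1Precision T φ σ).mulVec x := by
  obtain ⟨m, rfl⟩ : ∃ m, T = m + 1 := ⟨T - 1, by omega⟩
  have hform := dotProduct_ar1Precision_mulVec m (by omega) φ σ hσ x
  have ha : 0 < |φ| := abs_pos.mpr hφ0
  have hsq : φ ^ 2 = |φ| ^ 2 := (sq_abs φ).symm
  have hxx : x ⬝ᵥ x = ∑ i, x i ^ 2 := by
    simp only [dotProduct]
    exact Finset.sum_congr rfl fun i _ => by ring
  have hterm : ∀ y z : ℝ, 0 ≤ |φ| * y ^ 2 + |φ| * z ^ 2 - 2 * φ * (y * z) := by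
    intro y z
    rcases abs_cases φ with ⟨h, _⟩ | ⟨h, _⟩ <;> rw [h] at ha ⊢
    · nlinarith [mul_nonneg ha.le (sq_nonneg (y - z))]
    · nlinarith [mul_nonneg ha.le (sq_nonneg (y + z))]
  have hident : σ ^ 2 * (x ⬝ᵥ (ar1Precision (m + 1) φ σ).mulVec x)
      - (1 - |φ|) ^ 2 * (x ⬝ᵥ x) =
      ∑ i : Fin m, (|φ| * x i.castSucc ^ 2 + |φ| * x i.succ ^ 2
        - 2 * φ * (x i.castSucc * x i.succ))
      + (|φ| - |φ| ^ 2) * (x 0 ^ 2 + x (Fin.last m) ^ 2) := by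
    rw [hform, hxx, hsq, Finset.sum_sub_distrib, Finset.sum_add_distrib, ← Finset.mul_sum,
      ← Finset.mul_sum, ← Finset.mul_sum]
    have h1 := Fin.sum_univ_castSucc fun i => x i ^ 2
    have h2 := Fin.sum_univ_succ fun i => x i ^ 2
    linear_combination |φ| * h1 + |φ| * h2
  have hsum : 0 ≤ ∑ i : Fin m, (|φ| * x i.castSucc ^ 2 + |φ| * x i.succ ^ 2
      - 2 * φ * (x i.castSucc * x i.succ)) := Finset.sum_nonneg fun i _ => hterm _ _
  have hgap : 0 < |φ| - |φ| ^ 2 := by nlinarith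
  have hpos : 0 < σ ^ 2 * (x ⬝ᵥ (ar1Precision (m + 1) φ σ).mulVec x)
      - (1 - |φ|) ^ 2 * (x ⬝ᵥ x) := by
    rw [hident]
    by_contra! hle
    have hbdry := mul_nonneg hgap.le (add_nonneg (sq_nonneg (x 0)) (sq_nonneg (x (Fin.last m))))
    have hx0 : x 0 = 0 := by
      have h : x 0 ^ 2 + x (Fin.last m) ^ 2 = 0 := by
        have : (|φ| - |φ| ^ 2) * (x 0 ^ 2 + x (Fin.last m) ^ 2) = 0 := by linarith
        exact (mul_eq_zero.mp this).resolve_left hgap.ne'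
      nlinarith [sq_nonneg (x 0), sq_nonneg (x (Fin.last m))]
    have hzero := (Finset.sum_eq_zero_iff_of_nonneg fun i _ => hterm _ _).mp
      (le_antisymm (by linarith) hsum)
    refine hx (funext fun i => ?_)
    induction i using Fin.induction with
    | zero => exact hx0
    | succ i ih =>
      have h := hzero i (Finset.mem_univ i)
      simp only [Pi.zero_apply] at ih ⊢
      rw [ih] at h
      simpa [ha.ne', hφ0] using h
  have hσ2 : 0 < σ ^ 2 := by positivity
  rw [div_mul_eq_mul_div, div_lt_iff₀ hσ2]
  linarith

/-- A matrix with positive quadratic form is uniformly coercive. -/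
lemma exists_coercive_of_pos {d : ℕ} (M : Matrix (Fin d) (Fin d) ℝ)
    (hM : ∀ x, x ≠ 0 → 0 < x ⬝ᵥ M.mulVec x) :
    ∃ c, 0 < c ∧ ∀ x, c * (x ⬝ᵥ x) ≤ x ⬝ᵥ M.mulVec x := by
  have hcont : Continuous fun x : EuclideanSpace ℝ (Fin d) =>
      x.ofLp ⬝ᵥ M.mulVec x.ofLp := by
    simp only [dotProduct, mulVec]
    fun_prop
  have hnorm : ∀ x : Fin d → ℝ, x ⬝ᵥ x = ‖WithLp.toLp 2 x‖ ^ 2 := by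
    intro x
    rw [EuclideanSpace.norm_sq_eq]
    simp [dotProduct, sq]
  rcases (Metric.sphere (0 : EuclideanSpace ℝ (Fin d)) 1).eq_empty_or_nonempty with he | hne
  · refine ⟨1, one_pos, fun x => ?_⟩
    have hx : x = 0 := by
      by_contra hx
      have hx' : WithLp.toLp 2 x ≠ 0 := by simpa using hx
      refine Set.eq_empty_iff_forall_notMem.mp he
        (‖WithLp.toLp 2 x‖⁻¹ • WithLp.toLp 2 x) ?_
      simp [norm_smul, hx]
    simp [hx]
  · obtain ⟨y, hy, hmin⟩ := (isCompact_sphere (0 : EuclideanSpace ℝ (Fin d)) 1).exists_isMinOn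
      hne hcont.continuousOn
    have hy0 : y.ofLp ≠ 0 := by
      intro h
      have : y = 0 := by simpa using h
      simp [this] at hy
    refine ⟨_, hM _ hy0, fun x => ?_⟩
    by_cases hx : x = 0
    · simp [hx]
    have hx' : 0 < ‖WithLp.toLp 2 x‖ := by simpa using hx
    have h := hmin (a := ‖WithLp.toLp 2 x‖⁻¹ • WithLp.toLp 2 x) (by simp [norm_smul, hx])
    simp only [Set.mem_ofPred_eq, WithLp.ofLp_smul, mulVec_smul, dotProduct_smul, smul_dotProduct,
      smul_eq_mul] at h
    rw [hnorm x]
    calc _ ≤ (‖WithLp.toLp 2 x‖⁻¹ * (‖WithLp.toLp 2 x‖⁻¹ * (x ⬝ᵥ M.mulVec x)))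
          * ‖WithLp.toLp 2 x‖ ^ 2 := by gcongr
      _ = _ := by field_simp

lemma integrable_exp_neg_mul_dotProduct {d : ℕ} {c : ℝ} (hc : 0 < c) :
    Integrable fun x : Fin d → ℝ => Real.exp (-c * (x ⬝ᵥ x)) := by
  have h : Integrable fun x : Fin d → ℝ => ∏ i, Real.exp (-c * x i ^ 2) :=
    Integrable.fintype_prod (f := fun _ t => Real.exp (-c * t ^ 2)) fun _ =>
      integrable_exp_neg_mul_sq hc
  refine h.congr (ae_of_all _ fun x => ?_)
  simp only [dotProduct, ← Real.exp_sum, Finset.mul_sum, sq]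

/-- A quadratic function with positive leading form dominates a multiple of the squared norm. -/
lemma exists_quadratic_lower_bound {d : ℕ} (M : Matrix (Fin d) (Fin d) ℝ)
    (hM : ∀ x, x ≠ 0 → 0 < x ⬝ᵥ M.mulVec x) (b : Fin d → ℝ) :
    ∃ c, 0 < c ∧ ∃ K, ∀ x, b ⬝ᵥ x - (1 / 2) * (x ⬝ᵥ M.mulVec x) ≤ K - c * (x ⬝ᵥ x) := by
  obtain ⟨c, hc, h⟩ := exists_coercive_of_pos M hM
  refine ⟨c / 4, by positivity, (b ⬝ᵥ b) / c, fun x => ?_⟩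
  have hyoung : b ⬝ᵥ x ≤ (b ⬝ᵥ b) / c + c / 4 * (x ⬝ᵥ x) := by
    simp only [dotProduct, Finset.sum_div, Finset.mul_sum, ← Finset.sum_add_distrib]
    refine Finset.sum_le_sum fun i _ => ?_
    have : b i * b i / c + c / 4 * (x i * x i) - b i * x i = (b i - c / 2 * x i) ^ 2 / c := by
      field_simp
      ring
    have : 0 ≤ (b i - c / 2 * x i) ^ 2 / c := by positivity
    linarith
  linarith [h x]

lemma dotProduct_mulVec_sub_sub {d : ℕ} (P : Matrix (Fin d) (Fin d) ℝ) (x y : Fin d → ℝ) :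
    (x - y) ⬝ᵥ P.mulVec (x - y) =
      x ⬝ᵥ P.mulVec x - (P.mulVec y + y ᵥ* P) ⬝ᵥ x + y ⬝ᵥ P.mulVec y := by
  simp only [mulVec_sub, dotProduct_sub, sub_dotProduct, add_dotProduct, ← dotProduct_mulVec,
    dotProduct_comm (P.mulVec y) x]
  ring

/-- Finiteness of the `n`-th moment of importance weights between Gaussian densities with
precisions `P` (target) and `R` (proposal), when `n P - (n - 1) R` is positive definite. -/
lemma lintegral_importance_weight_lt_top {d : ℕ} (P R : Matrix (Fin d) (Fin d) ℝ) (n : ℝ)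
    (hn : 0 ≤ n) (hM : ∀ x, x ≠ 0 → 0 < x ⬝ᵥ (n • P - (n - 1) • R).mulVec x)
    (l : (Fin d → ℝ) → ℝ) (k : ℝ) (δ : Fin d → ℝ) (hbound : ∀ α, l α ≤ k + δ ⬝ᵥ α)
    (μ μs : Fin d → ℝ) :
    ∫⁻ α, ENNReal.ofReal
      ((Real.exp (l α) * gaussDensity μ P α / gaussDensity μs R α) ^ n *
        gaussDensity μs R α) < ⊤ := by
  set C₁ := (2 * Real.pi) ^ (-(d : ℝ) / 2) * Real.sqrt P.det with hC₁
  set C₂ := (2 * Real.pi) ^ (-(d : ℝ) / 2) * Real.sqrt R.det with hC₂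
  have hC₁0 : 0 ≤ C₁ := by positivity
  have hC₂0 : 0 ≤ C₂ := by positivity
  obtain ⟨c, hc, K, hK⟩ := exists_quadratic_lower_bound _ hM
    (n • δ + (n / 2) • (P.mulVec μ + μ ᵥ* P) - ((n - 1) / 2) • (R.mulVec μs + μs ᵥ* R))
  set L := n * k - n / 2 * (μ ⬝ᵥ P.mulVec μ) + (n - 1) / 2 * (μs ⬝ᵥ R.mulVec μs) + K with hL
  have hle : ∀ α, (Real.exp (l α) * gaussDensity μ P α / gaussDensity μs R α) ^ n *
      gaussDensity μs R α ≤ (C₁ / C₂) ^ n * C₂ * Real.exp L * Real.exp (-c * (α ⬝ᵥ α)) := by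
    intro α
    set p := -(1 / 2) * ((α - μ) ⬝ᵥ P.mulVec (α - μ)) with hp
    set r := -(1 / 2) * ((α - μs) ⬝ᵥ R.mulVec (α - μs)) with hr
    have hweight : Real.exp (l α) * gaussDensity μ P α / gaussDensity μs R α
        = C₁ / C₂ * Real.exp (l α + p - r) := by
      simp only [gaussDensity, ← hC₁, ← hC₂, ← hp, ← hr, Real.exp_sub, Real.exp_add]
      rw [div_mul_div_comm]
      congr 1
      ring
    have hg : gaussDensity μs R α = C₂ * Real.exp r := rfl
    rw [hweight, hg, Real.mul_rpow (by positivity) (Real.exp_pos _).le, ← Real.exp_mul]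
    have hexp : (l α + p - r) * n + r ≤ L + -c * (α ⬝ᵥ α) := by
      have h := hK α
      simp only [sub_mulVec, smul_mulVec, dotProduct_sub, dotProduct_smul, sub_dotProduct,
        add_dotProduct (n • δ), smul_dotProduct, smul_eq_mul] at h
      rw [dotProduct_mulVec_sub_sub] at hp hr
      have hb := mul_le_mul_of_nonneg_left (hbound α) hn
      rw [hp, hr, hL]
      linarith
    calc _ = (C₁ / C₂) ^ n * C₂ * Real.exp ((l α + p - r) * n + r) := by
          rw [Real.exp_add]; ring
      _ ≤ (C₁ / C₂) ^ n * C₂ * Real.exp (L + -c * (α ⬝ᵥ α)) := by gcongr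
      _ = _ := by rw [Real.exp_add]; ring
  refine (lintegral_mono fun α => ENNReal.ofReal_le_ofReal (hle α)).trans_lt ?_
  exact ((integrable_exp_neg_mul_dotProduct hc).const_mul _).lintegral_lt_top

theorem stmt4 (T : ℕ) (hT : 2 ≤ T) (φ : ℝ) (hφ0 : φ ≠ 0) (hφ1 : |φ| < 1)
    (σ : ℝ) (hσ : 0 < σ)
    (l : (Fin T → ℝ) → ℝ) (hl : Measurable l)
    (k : ℝ) (δ : Fin T → ℝ) (hbound : ∀ α, l α ≤ k + δ ⬝ᵥ α)
    (n : ℝ) (hn : 1 ≤ n)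
    (v : ℝ) (hv : 0 < v)
    (hvge : (n - 1) * (σ ^ 2 / (1 - φ ^ 2)) * (1 + |φ|) / (1 - |φ|) ≤ v)
    (μ μs : Fin T → ℝ) :
    ∫⁻ α, ENNReal.ofReal
      ((Real.exp (l α) * gaussDensity μ (ar1Precision T φ σ) α /
          gaussDensity μs (ar1Precision T φ σ + v⁻¹ • (1 : Matrix (Fin T) (Fin T) ℝ)) α) ^ n *
        gaussDensity μs (ar1Precision T φ σ + v⁻¹ • (1 : Matrix (Fin T) (Fin T) ℝ)) α) < ⊤ := by
  refine lintegral_importance_weight_lt_top _ _ n (by linarith) (fun x hx => ?_) l k δ hbound μ μs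
  have hlow := ar1Precision_strict_lower_bound T hT φ hφ0 hφ1 σ hσ x hx
  have hxx : 0 ≤ x ⬝ᵥ x := Finset.sum_nonneg fun i _ => mul_self_nonneg (x i)
  have h1 : 0 < 1 - |φ| := by linarith
  have h2 : 0 < 1 + |φ| := by linarith [abs_nonneg φ]
  have hscale : (n - 1) * v⁻¹ ≤ (1 - |φ|) ^ 2 / σ ^ 2 := by
    have hfac : 1 - φ ^ 2 = (1 - |φ|) * (1 + |φ|) := by rw [← sq_abs φ]; ring
    have heq : (n - 1) * (σ ^ 2 / (1 - φ ^ 2)) * (1 + |φ|) / (1 - |φ|)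
        = (n - 1) * σ ^ 2 / (1 - |φ|) ^ 2 := by
      rw [hfac]
      field_simp
    rw [heq, div_le_iff₀ (by positivity)] at hvge
    rw [← div_eq_mul_inv, div_le_div_iff₀ hv (by positivity)]
    linarith
  have hquad : x ⬝ᵥ (n • ar1Precision T φ σ - (n - 1) • (ar1Precision T φ σ + v⁻¹ • 1)).mulVec x
      = x ⬝ᵥ (ar1Precision T φ σ).mulVec x - (n - 1) * v⁻¹ * (x ⬝ᵥ x) := by
    simp only [sub_mulVec, smul_mulVec, add_mulVec, one_mulVec, dotProduct_sub, dotProduct_add,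
      dotProduct_smul, smul_eq_mul]
    ring
  rw [hquad]
  linarith [mul_le_mul_of_nonneg_right hscale hxx]
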